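/- For skew Schur polynomials in finitely many variables: if (λ₁,μ₁), (λ₂,μ₂), (λ₃,μ₃) are pairs of partitions with μᵢ ⊆ λᵢ and (λ₂,μ₂) = ½(λ₁,μ₁) + ½(λ₃,μ₃) componentwise, then at any point z ∈ ℝ≥0ⁿ, s_{λ₂/μ₂}(z)² ≥ s_{λ₁/μ₁}(z) · s_{λ₃/μ₃}(z). -/

import Mathlib

/-- The cells of the skew Young diagram `λ/μ` (rows and columns indexed from 0). -/
def skewCells (lam mu : ℕ → ℕ) : Set (ℕ × ℕ) :=
  {p | mu p.1 ≤ p.2 ∧ p.2 < lam p.1}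

/-- `T` is a semistandard Young tableau of shape `λ/μ` with entries in `{0, …, n-1}`:
rows weakly increase, columns strictly increase, and `T` is `0` outside the diagram. -/
def IsSSYT (n : ℕ) [NeZero n] (lam mu : ℕ → ℕ) (T : ℕ × ℕ → Fin n) : Prop :=
  (∀ i j : ℕ, (i, j) ∈ skewCells lam mu → (i, j + 1) ∈ skewCells lam mu →
    T (i, j) ≤ T (i, j + 1)) ∧
  (∀ i j : ℕ, (i, j) ∈ skewCells lam mu → (i + 1, j) ∈ skewCells lam mu →
    T (i, j) < T (i + 1, j)) ∧
  (∀ p ∉ skewCells lam mu, T p = 0)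

/-- The skew Schur polynomial `s_{λ/μ}(z₁, …, z_n) = Σ_T z^T`. -/
noncomputable def skewSchur (n : ℕ) [NeZero n] (lam mu : ℕ → ℕ) (z : Fin n → ℝ) : ℝ :=
  ∑ᶠ T ∈ {T : ℕ × ℕ → Fin n | IsSSYT n lam mu T}, ∏ᶠ p ∈ skewCells lam mu, z (T p)

/-- The relation required of two vertically adjacent entries of an extended tableau: strict
increase, except that the two extreme values may repeat. -/
def ColumnRel {E : Type*} [LinearOrder E] [BoundedOrder E] (a b : E) : Prop :=
  a < b ∨ (a = ⊥ ∧ b = ⊥) ∨ (a = ⊤ ∧ b = ⊤)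

lemma ColumnRel.sup {E : Type*} [LinearOrder E] [BoundedOrder E] {a b c d : E}
    (h : ColumnRel a b) (h' : ColumnRel c d) : ColumnRel (a ⊔ c) (b ⊔ d) := by
  rcases h with h | ⟨rfl, rfl⟩ | ⟨rfl, rfl⟩
  · rcases h' with h' | ⟨rfl, rfl⟩ | ⟨rfl, rfl⟩
    · exact Or.inl (max_lt_max h h')
    · simpa [ColumnRel] using Or.inl h
    · simp [ColumnRel]
  · simpa using h'
  · simp [ColumnRel]

lemma ColumnRel.inf {E : Type*} [LinearOrder E] [BoundedOrder E] {a b c d : E}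
    (h : ColumnRel a b) (h' : ColumnRel c d) : ColumnRel (a ⊓ c) (b ⊓ d) := by
  rcases h with h | ⟨rfl, rfl⟩ | ⟨rfl, rfl⟩
  · rcases h' with h' | ⟨rfl, rfl⟩ | ⟨rfl, rfl⟩
    · exact Or.inl (min_lt_min h h')
    · simp [ColumnRel]
    · simpa [ColumnRel] using Or.inl h
  · simp [ColumnRel]
  · simpa using h'

/-- Tableaux of shape `λ/μ` extended to all of `ℕ × ℤ`, by `⊥` to the left of the diagram and
by `⊤` to its right. -/
def extTableaux (n : ℕ) (lam mu : ℕ → ℤ) : Set (ℕ × ℤ → WithBot (WithTop (Fin n))) :=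
  {T | (∀ i j, T (i, j) ≤ T (i, j + 1)) ∧ (∀ i j, ColumnRel (T (i, j)) (T (i + 1, j))) ∧
    ∀ i j, (T (i, j) = ⊥ ↔ j < mu i) ∧ (T (i, j) = ⊤ ↔ lam i ≤ j)}

lemma sup_mem_extTableaux {n : ℕ} {lam mu lam' mu' : ℕ → ℤ}
    {S T : ℕ × ℤ → WithBot (WithTop (Fin n))}
    (hS : S ∈ extTableaux n lam mu) (hT : T ∈ extTableaux n lam' mu') :
    S ⊔ T ∈ extTableaux n (lam ⊓ lam') (mu ⊓ mu') := by
  refine ⟨fun i j => sup_le_sup (hS.1 i j) (hT.1 i j),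
    fun i j => (hS.2.1 i j).sup (hT.2.1 i j), fun i j => ⟨?_, ?_⟩⟩
  · simp [(hS.2.2 i j).1, (hT.2.2 i j).1]
  · simp [max_eq_top, (hS.2.2 i j).2, (hT.2.2 i j).2]

lemma inf_mem_extTableaux {n : ℕ} {lam mu lam' mu' : ℕ → ℤ}
    {S T : ℕ × ℤ → WithBot (WithTop (Fin n))}
    (hS : S ∈ extTableaux n lam mu) (hT : T ∈ extTableaux n lam' mu') :
    S ⊓ T ∈ extTableaux n (lam ⊔ lam') (mu ⊔ mu') := by
  refine ⟨fun i j => inf_le_inf (hS.1 i j) (hT.1 i j),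
    fun i j => (hS.2.1 i j).inf (hT.2.1 i j), fun i j => ⟨?_, ?_⟩⟩
  · simp [min_eq_bot, (hS.2.2 i j).1, (hT.2.2 i j).1]
  · simp [(hS.2.2 i j).2, (hT.2.2 i j).2]

/-- The cells of a skew diagram whose rows may extend to negative columns. -/
def intCells (lam mu : ℕ → ℤ) : Set (ℕ × ℤ) :=
  {p | mu p.1 ≤ p.2 ∧ p.2 < lam p.1}

lemma finite_intCells {lam mu : ℕ → ℤ} (h : {i | lam i ≠ mu i}.Finite) :
    (intCells lam mu).Finite := by
  refine (h.biUnion fun i _ => (Set.finite_singleton i).prod (Set.finite_Ico (mu i) (lam i))).subset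
    fun p hp => ?_
  simp only [Set.mem_iUnion]
  exact ⟨p.1, (hp.1.trans_lt hp.2).ne', rfl, hp⟩

lemma finite_extTableaux (n : ℕ) {lam mu : ℕ → ℤ} (h : {i | lam i ≠ mu i}.Finite) :
    (extTableaux n lam mu).Finite := by
  have := (finite_intCells h).to_subtype
  have : Finite (WithBot (WithTop (Fin n))) := inferInstanceAs (Finite (Option (Option (Fin n))))
  refine Set.Finite.of_injOn (f := fun T (p : intCells lam mu) => T p) (Set.mapsTo_univ _ _) ?_
    Set.finite_univ
  intro S hS T hT hST
  ext1 ⟨i, j⟩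
  by_cases h1 : j < mu i
  · rw [(hS.2.2 i j).1.2 h1, (hT.2.2 i j).1.2 h1]
  by_cases h2 : lam i ≤ j
  · rw [(hS.2.2 i j).2.2 h2, (hT.2.2 i j).2.2 h2]
  · exact congrFun hST ⟨(i, j), not_lt.1 h1, not_le.1 h2⟩

/-- The weight of an entry: `z k` for a genuine entry `k`, and `1` for `⊥` and `⊤`. -/
def entryWeight {n : ℕ} (z : Fin n → ℝ) (e : WithBot (WithTop (Fin n))) : ℝ :=
  WithBot.recBotCoe 1 (WithTop.recTopCoe 1 z) e

lemma entryWeight_nonneg {n : ℕ} {z : Fin n → ℝ} (hz : ∀ i, 0 ≤ z i)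
    (e : WithBot (WithTop (Fin n))) : 0 ≤ entryWeight z e := by
  induction e using WithBot.recBotCoe with
  | bot => exact zero_le_one
  | coe e =>
    induction e using WithTop.recTopCoe with
    | top => exact zero_le_one
    | coe e => exact hz e

lemma mulSupport_entryWeight_subset {n : ℕ} (z : Fin n → ℝ) {lam mu : ℕ → ℤ}
    {T : ℕ × ℤ → WithBot (WithTop (Fin n))} (hT : T ∈ extTableaux n lam mu) :
    Function.mulSupport (fun p => entryWeight z (T p)) ⊆ intCells lam mu := by
  rintro ⟨i, j⟩ hp
  by_contra hc
  apply hp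
  rcases lt_or_ge j (mu i) with h | h
  · simp only [(hT.2.2 i j).1.2 h]
    rfl
  · have h2 : lam i ≤ j := not_lt.1 fun h2 => hc ⟨h, h2⟩
    simp only [(hT.2.2 i j).2.2 h2]
    rfl

/-- The weight of an extended tableau. -/
noncomputable def tableauWeight {n : ℕ} (z : Fin n → ℝ) (T : ℕ × ℤ → WithBot (WithTop (Fin n))) :
    ℝ :=
  ∏ᶠ p, entryWeight z (T p)

lemma tableauWeight_nonneg {n : ℕ} {z : Fin n → ℝ} (hz : ∀ i, 0 ≤ z i)
    (T : ℕ × ℤ → WithBot (WithTop (Fin n))) : 0 ≤ tableauWeight z T :=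
  finprod_nonneg fun _ => entryWeight_nonneg hz _

/-- The skew Schur polynomial as a sum over extended tableaux. -/
noncomputable def extSchur {n : ℕ} (z : Fin n → ℝ) (lam mu : ℕ → ℤ) : ℝ :=
  ∑ᶠ T ∈ extTableaux n lam mu, tableauWeight z T

lemma extSchur_nonneg {n : ℕ} {z : Fin n → ℝ} (hz : ∀ i, 0 ≤ z i) (lam mu : ℕ → ℤ) :
    0 ≤ extSchur z lam mu :=
  finsum_nonneg fun _ => finsum_nonneg fun _ => tableauWeight_nonneg hz _

lemma finite_ne_sup {a b c d : ℕ → ℤ} (h : {i | a i ≠ b i}.Finite) (h' : {i | c i ≠ d i}.Finite) :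
    {i | (a ⊔ c) i ≠ (b ⊔ d) i}.Finite := by
  refine (h.union h').subset fun i hi => ?_
  by_contra hc
  simp_all

lemma finite_ne_inf {a b c d : ℕ → ℤ} (h : {i | a i ≠ b i}.Finite) (h' : {i | c i ≠ d i}.Finite) :
    {i | (a ⊓ c) i ≠ (b ⊓ d) i}.Finite := by
  refine (h.union h').subset fun i hi => ?_
  by_contra hc
  simp_all

lemma tableauWeight_mul {n : ℕ} (z : Fin n → ℝ) {lam mu lam' mu' : ℕ → ℤ}
    (h : {i | lam i ≠ mu i}.Finite) (h' : {i | lam' i ≠ mu' i}.Finite)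
    {S T : ℕ × ℤ → WithBot (WithTop (Fin n))}
    (hS : S ∈ extTableaux n lam mu) (hT : T ∈ extTableaux n lam' mu') :
    tableauWeight z S * tableauWeight z T = tableauWeight z (S ⊓ T) * tableauWeight z (S ⊔ T) := by
  have fin {l m : ℕ → ℤ} {U : ℕ × ℤ → WithBot (WithTop (Fin n))} (hl : {i | l i ≠ m i}.Finite)
      (hU : U ∈ extTableaux n l m) : (Function.mulSupport fun p => entryWeight z (U p)).Finite :=
    (finite_intCells hl).subset (mulSupport_entryWeight_subset z hU)
  unfold tableauWeight
  rw [← finprod_mul_distrib (fin h hS) (fin h' hT),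
    ← finprod_mul_distrib (fin (finite_ne_sup h h') (inf_mem_extTableaux hS hT))
      (fin (finite_ne_inf h h') (sup_mem_extTableaux hS hT))]
  refine finprod_congr fun p => ?_
  rcases le_total (S p) (T p) with hp | hp
  · simp [hp]
  · simp [hp, mul_comm]

/-- Log-supermodularity of skew Schur functions on the lattice of skew shapes. -/
lemma extSchur_mul_le {n : ℕ} {z : Fin n → ℝ} (hz : ∀ i, 0 ≤ z i) {lam mu lam' mu' : ℕ → ℤ}
    (h : {i | lam i ≠ mu i}.Finite) (h' : {i | lam' i ≠ mu' i}.Finite) :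
    extSchur z lam mu * extSchur z lam' mu' ≤
      extSchur z (lam ⊔ lam') (mu ⊔ mu') * extSchur z (lam ⊓ lam') (mu ⊓ mu') := by
  classical
  let f (l m : ℕ → ℤ) : (ℕ × ℤ → WithBot (WithTop (Fin n))) → ℝ :=
    (extTableaux n l m).indicator (tableauWeight z)
  have hf (l m : ℕ → ℤ) : 0 ≤ f l m :=
    fun T => Set.indicator_nonneg (fun T _ => tableauWeight_nonneg hz T) T
  have sum_eq {l m : ℕ → ℤ} (hl : {i | l i ≠ m i}.Finite) :
      extSchur z l m = ∑ T ∈ (finite_extTableaux n hl).toFinset, f l m T := by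
    rw [extSchur, finsum_mem_eq_finite_toFinset_sum _ (finite_extTableaux n hl)]
    refine Finset.sum_congr rfl fun T hT => ?_
    exact (Set.indicator_of_mem ((Set.Finite.mem_toFinset _).1 hT) _).symm
  have key := four_functions_theorem (f lam mu) (f lam' mu') (f (lam ⊔ lam') (mu ⊔ mu'))
    (f (lam ⊓ lam') (mu ⊓ mu')) (hf _ _) (hf _ _) (hf _ _) (hf _ _) (fun S T => by
      by_cases hS : S ∈ extTableaux n lam mu
      · by_cases hT : T ∈ extTableaux n lam' mu'
        · simp only [f, Set.indicator_of_mem hS, Set.indicator_of_mem hT,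
            Set.indicator_of_mem (inf_mem_extTableaux hS hT),
            Set.indicator_of_mem (sup_mem_extTableaux hS hT)]
          exact (tableauWeight_mul z h h' hS hT).le
        · simp only [f, Set.indicator_of_notMem hT, mul_zero]
          exact mul_nonneg (hf _ _ _) (hf _ _ _)
      · simp only [f, Set.indicator_of_notMem hS, zero_mul]
        exact mul_nonneg (hf _ _ _) (hf _ _ _))
    (finite_extTableaux n h).toFinset (finite_extTableaux n h').toFinset
  rw [sum_eq h, sum_eq h', sum_eq (finite_ne_sup h h'), sum_eq (finite_ne_inf h h')]
  refine key.trans (mul_le_mul ?_ ?_ (Finset.sum_nonneg fun T _ => hf _ _ T)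
    (Finset.sum_nonneg fun T _ => hf _ _ T))
  · refine Finset.sum_le_sum_of_subset_of_nonneg (fun U hU => ?_) fun T _ _ => hf _ _ T
    obtain ⟨S, hS, T, hT, rfl⟩ := Finset.mem_infs.1 hU
    simp only [Set.Finite.mem_toFinset] at *
    exact inf_mem_extTableaux hS hT
  · refine Finset.sum_le_sum_of_subset_of_nonneg (fun U hU => ?_) fun T _ _ => hf _ _ T
    obtain ⟨S, hS, T, hT, rfl⟩ := Finset.mem_sups.1 hU
    simp only [Set.Finite.mem_toFinset] at *
    exact sup_mem_extTableaux hS hT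

lemma comp_shift_mem_extTableaux {n : ℕ} {lam mu : ℕ → ℤ} (c : ℤ)
    {T : ℕ × ℤ → WithBot (WithTop (Fin n))} (hT : T ∈ extTableaux n lam mu) :
    (fun p => T (p.1, p.2 - c)) ∈ extTableaux n (fun i => lam i + c) (fun i => mu i + c) := by
  refine ⟨fun i j => ?_, fun i j => hT.2.1 i (j - c), fun i j => ⟨?_, ?_⟩⟩
  · simpa only [add_sub_right_comm] using hT.1 i (j - c)
  · rw [(hT.2.2 i (j - c)).1, sub_lt_iff_lt_add]
  · rw [(hT.2.2 i (j - c)).2, le_sub_iff_add_le]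

lemma extSchur_shift {n : ℕ} (z : Fin n → ℝ) (lam mu : ℕ → ℤ) (c : ℤ) :
    extSchur z (fun i => lam i + c) (fun i => mu i + c) = extSchur z lam mu := by
  symm
  refine finsum_mem_eq_of_bijOn (fun T p => T (p.1, p.2 - c)) ⟨?_, ?_, ?_⟩ fun T _ => ?_
  · exact fun T hT => comp_shift_mem_extTableaux c hT
  · intro S _ T _ hST
    ext1 p
    simpa using congrFun hST (p.1, p.2 + c)
  · intro T hT
    refine ⟨fun p => T (p.1, p.2 + c), ?_, by simp⟩
    simpa using comp_shift_mem_extTableaux (-c) hT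
  · exact (finprod_comp_equiv ((Equiv.refl ℕ).prodCongr (Equiv.subRight c))
      (f := fun p => entryWeight z (T p))).symm

lemma extSchur_add_mul_sub_le {n : ℕ} {z : Fin n → ℝ} (hz : ∀ i, 0 ≤ z i) {x y : ℕ → ℤ}
    (hxy : {i | x i ≠ y i}.Finite) (m : ℕ) (a : ℤ) {e e' : ℕ → ℤ}
    (hee : {i | e i ≠ e' i}.Finite) (he : ∀ i, a ≤ e i ∧ e i ≤ a + m)
    (he' : ∀ i, a ≤ e' i ∧ e' i ≤ a + m) :
    extSchur z (fun i => x i + e i) (fun i => y i + e' i) *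
      extSchur z (fun i => x i - e i) (fun i => y i - e' i) ≤ extSchur z x y ^ 2 := by
  induction m using Nat.strong_induction_on generalizing a e e' with
  | _ m ih =>
  obtain rfl | hm := Nat.eq_zero_or_pos m
  · obtain rfl : e = fun _ => a := funext fun i => by have := he i; push_cast at this; omega
    obtain rfl : e' = fun _ => a := funext fun i => by have := he' i; push_cast at this; omega
    simp only [sub_eq_add_neg, extSchur_shift, sq, le_refl]
  · set c : ℤ := 2 * a + m with hc
    have hadd : {i | x i + e i ≠ y i + e' i}.Finite :=
      (hxy.union hee).subset fun i hi => by by_contra hn; simp_all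
    have hsub : {i | x i - e i + c ≠ y i - e' i + c}.Finite :=
      (hxy.union hee).subset fun i hi => by by_contra hn; simp_all
    have hrefl : {i | max (e i) (c - e i) ≠ max (e' i) (c - e' i)}.Finite :=
      hee.subset fun i hi => by by_contra hn; simp_all
    have hsup (x e : ℕ → ℤ) : (fun i => x i + e i) ⊔ (fun i => x i - e i + c) =
        fun i => x i + max (e i) (c - e i) := by
      ext i; simp only [Pi.sup_apply]; omega
    have hinf (x e : ℕ → ℤ) : (fun i => x i + e i) ⊓ (fun i => x i - e i + c) =
        fun i => x i - max (e i) (c - e i) + c := by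
      ext i; simp only [Pi.inf_apply]; omega
    have key := extSchur_mul_le hz hadd hsub
    rw [hsup, hsup, hinf, hinf, extSchur_shift, extSchur_shift] at key
    exact key.trans (ih (m / 2) (by omega) (a + (m - m / 2 : ℕ)) hrefl
      (fun i => by have := he i; omega) (fun i => by have := he' i; omega))

section Extension

variable {n : ℕ}

/-- The extension of a filling of `λ/μ` by `⊥` and `⊤`. -/
def extendTableau (lam mu : ℕ → ℕ) (T : ℕ × ℕ → Fin n) (p : ℕ × ℤ) : WithBot (WithTop (Fin n)) :=
  if p.2 < mu p.1 then ⊥ else if (lam p.1 : ℤ) ≤ p.2 then ⊤ else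
    ((T (p.1, p.2.toNat) : WithTop (Fin n)) : WithBot (WithTop (Fin n)))

lemma extendTableau_of_lt {lam mu : ℕ → ℕ} (T : ℕ × ℕ → Fin n) {i : ℕ} {j : ℤ}
    (h : j < mu i) : extendTableau lam mu T (i, j) = ⊥ := if_pos h

lemma extendTableau_of_le {lam mu : ℕ → ℕ} (hsub : ∀ i, mu i ≤ lam i) (T : ℕ × ℕ → Fin n)
    {i : ℕ} {j : ℤ} (h : lam i ≤ j) : extendTableau lam mu T (i, j) = ⊤ := by
  have := hsub i
  exact (if_neg (by dsimp only; omega)).trans (if_pos h)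

lemma extendTableau_coe {lam mu : ℕ → ℕ} (T : ℕ × ℕ → Fin n) {i j : ℕ}
    (h : (i, j) ∈ skewCells lam mu) :
    extendTableau lam mu T (i, (j : ℤ)) = ((T (i, j) : WithTop (Fin n)) : WithBot _) := by
  obtain ⟨h1, h2⟩ := h
  exact (if_neg (by dsimp only at *; omega)).trans (if_neg (by dsimp only at *; omega))

lemma cases_column (lam mu : ℕ → ℕ) (i : ℕ) (j : ℤ) :
    j < mu i ∨ (lam i : ℤ) ≤ j ∨ ∃ k : ℕ, j = k ∧ (i, k) ∈ skewCells lam mu := by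
  by_cases h1 : j < mu i
  · exact Or.inl h1
  by_cases h2 : (lam i : ℤ) ≤ j
  · exact Or.inr (Or.inl h2)
  · refine Or.inr (Or.inr ⟨j.toNat, by omega, ?_, ?_⟩) <;> dsimp only <;> omega

lemma extendTableau_mem [NeZero n] {lam mu : ℕ → ℕ} (hlam : Antitone lam) (hmu : Antitone mu)
    (hsub : ∀ i, mu i ≤ lam i) {T : ℕ × ℕ → Fin n} (hT : IsSSYT n lam mu T) :
    extendTableau lam mu T ∈ extTableaux n (fun i => lam i) (fun i => mu i) := by
  refine ⟨fun i j => ?_, fun i j => ?_, fun i j => ?_⟩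
  · rcases cases_column lam mu i j with h | h | ⟨j, rfl, h⟩
    · simp [extendTableau_of_lt T h]
    · simp [extendTableau_of_le hsub T (h.trans (by omega : j ≤ j + 1))]
    · by_cases h' : (i, j + 1) ∈ skewCells lam mu
      · rw [extendTableau_coe T h]
        have := extendTableau_coe T h'
        push_cast at this
        rw [this]
        exact_mod_cast hT.1 i j h h'
      · have : (lam i : ℤ) ≤ j + 1 := by
          by_contra hc
          exact h' ⟨by have := h.1; dsimp only at *; omega, by dsimp only; omega⟩
        simp [extendTableau_of_le hsub T this]
  · have hl : lam (i + 1) ≤ lam i := hlam (Nat.le_succ i)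
    have hm : mu (i + 1) ≤ mu i := hmu (Nat.le_succ i)
    rcases cases_column lam mu i j with h | h | ⟨j, rfl, h⟩
    · rw [extendTableau_of_lt T h]
      rcases eq_bot_or_bot_lt (extendTableau lam mu T (i + 1, j)) with hb | hb
      · exact Or.inr (Or.inl ⟨rfl, hb⟩)
      · exact Or.inl hb
    · rw [extendTableau_of_le hsub T h, extendTableau_of_le hsub T (by omega)]
      exact Or.inr (Or.inr ⟨rfl, rfl⟩)
    · left
      rw [extendTableau_coe T h]
      by_cases h' : (i + 1, j) ∈ skewCells lam mu
      · rw [extendTableau_coe T h']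
        exact_mod_cast hT.2.1 i j h h'
      · have : (lam (i + 1) : ℤ) ≤ j := by
          by_contra hc
          exact h' ⟨by have := h.1; dsimp only at *; omega, by dsimp only; omega⟩
        rw [extendTableau_of_le hsub T this]
        exact WithBot.coe_lt_coe.2 (WithTop.coe_lt_top _)
  · have hs := hsub i
    rcases cases_column lam mu i j with h | h | ⟨j, rfl, h⟩
    · rw [extendTableau_of_lt T h]
      exact ⟨by simpa using h, iff_of_false bot_ne_top (by dsimp only; omega)⟩
    · rw [extendTableau_of_le hsub T h]
      exact ⟨iff_of_false top_ne_bot (by dsimp only; omega), by simpa using h⟩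
    · rw [extendTableau_coe T h]
      obtain ⟨h1, h2⟩ := h
      dsimp only at h1 h2
      exact ⟨iff_of_false WithBot.coe_ne_bot (by dsimp only; omega),
        iff_of_false (fun hc => WithTop.coe_ne_top (WithBot.coe_injective hc))
          (by dsimp only; omega)⟩

lemma extendTableau_injOn [NeZero n] (lam mu : ℕ → ℕ) :
    Set.InjOn (extendTableau lam mu) {T : ℕ × ℕ → Fin n | IsSSYT n lam mu T} := by
  intro S hS T hT hST
  ext1 ⟨i, j⟩
  by_cases h : (i, j) ∈ skewCells lam mu
  · have := congrFun hST (i, j)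
    rw [extendTableau_coe S h, extendTableau_coe T h] at this
    exact_mod_cast this
  · rw [hS.2.2 _ h, hT.2.2 _ h]

lemma extendTableau_surjOn [NeZero n] {lam mu : ℕ → ℕ} (hsub : ∀ i, mu i ≤ lam i) :
    Set.SurjOn (extendTableau lam mu) {T : ℕ × ℕ → Fin n | IsSSYT n lam mu T}
      (extTableaux n (fun i => lam i) (fun i => mu i)) := by
  intro U hU
  have hex (p : ℕ × ℕ) : ∃ k : Fin n,
      (p ∈ skewCells lam mu → U (p.1, p.2) = ((k : WithTop (Fin n)) : WithBot _)) ∧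
      (p ∉ skewCells lam mu → k = 0) := by
    by_cases hp : p ∈ skewCells lam mu
    · have h1 : U (p.1, p.2) ≠ ⊥ := fun hc => by
        have := (hU.2.2 p.1 p.2).1.1 hc
        have := hp.1
        dsimp only at *
        omega
      have h2 : U (p.1, p.2) ≠ ⊤ := fun hc => by
        have := (hU.2.2 p.1 p.2).2.1 hc
        have := hp.2
        dsimp only at *
        omega
      obtain ⟨u, hu⟩ := WithBot.ne_bot_iff_exists.1 h1
      obtain ⟨k, rfl⟩ := WithTop.ne_top_iff_exists.1
        (fun hc : u = ⊤ => h2 (by rw [← hu, hc]; rfl))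
      exact ⟨k, fun _ => hu.symm, fun h => absurd hp h⟩
    · exact ⟨0, fun h => absurd h hp, fun _ => rfl⟩
  choose T hT hT0 using hex
  refine ⟨T, ⟨fun i j h h' => ?_, fun i j h h' => ?_, hT0⟩, ?_⟩
  · have := hU.1 i j
    have h1 := hT _ h'
    push_cast at h1
    rw [hT _ h, h1] at this
    exact_mod_cast this
  · have := hU.2.1 i j
    rw [hT _ h, hT _ h'] at this
    rcases this with this | ⟨hb, -⟩ | ⟨ht, -⟩
    · exact_mod_cast this
    · exact absurd hb WithBot.coe_ne_bot
    · exact absurd (WithBot.coe_injective ht) WithTop.coe_ne_top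
  · ext1 ⟨i, j⟩
    rcases cases_column lam mu i j with h | h | ⟨j, rfl, h⟩
    · rw [extendTableau_of_lt T h, (hU.2.2 i j).1.2 h]
    · rw [extendTableau_of_le hsub T h, (hU.2.2 i j).2.2 h]
    · rw [extendTableau_coe T h, hT _ h]

lemma tableauWeight_extendTableau [NeZero n] (z : Fin n → ℝ) {lam mu : ℕ → ℕ} (hlam : Antitone lam)
    (hmu : Antitone mu) (hsub : ∀ i, mu i ≤ lam i) {T : ℕ × ℕ → Fin n} (hT : IsSSYT n lam mu T) :
    ∏ᶠ p ∈ skewCells lam mu, z (T p) = tableauWeight z (extendTableau lam mu T) := by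
  have hsupp := mulSupport_entryWeight_subset z (extendTableau_mem hlam hmu hsub hT)
  rw [tableauWeight, ← finprod_mem_univ fun p => entryWeight z (extendTableau lam mu T p),
    finprod_mem_inter_mulSupport_eq' _ Set.univ (intCells (fun i => lam i) (fun i => mu i))
      fun p hp => iff_of_true trivial (hsupp hp)]
  refine finprod_mem_eq_of_bijOn (fun p => (p.1, (p.2 : ℤ))) ⟨?_, ?_, ?_⟩ ?_
  · rintro ⟨i, j⟩ ⟨h1, h2⟩
    exact ⟨Int.ofNat_le.2 h1, Int.ofNat_lt.2 h2⟩
  · rintro ⟨i, j⟩ - ⟨i', j'⟩ - h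
    simpa using h
  · rintro ⟨i, j⟩ ⟨h1, h2⟩
    rcases cases_column lam mu i j with h | h | ⟨j, rfl, h⟩
    · exact absurd h h1.not_gt
    · exact absurd h h2.not_ge
    · exact ⟨(i, j), h, rfl⟩
  · rintro ⟨i, j⟩ h
    dsimp only
    rw [extendTableau_coe T h]
    rfl

lemma skewSchur_eq_extSchur [NeZero n] (z : Fin n → ℝ) {lam mu : ℕ → ℕ} (hlam : Antitone lam)
    (hmu : Antitone mu) (hsub : ∀ i, mu i ≤ lam i) :
    skewSchur n lam mu z = extSchur z (fun i => lam i) (fun i => mu i) :=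
  finsum_mem_eq_of_bijOn (extendTableau lam mu)
    ⟨fun _ hT => extendTableau_mem hlam hmu hsub hT, extendTableau_injOn lam mu,
      extendTableau_surjOn hsub⟩
    fun _ hT => tableauWeight_extendTableau z hlam hmu hsub hT

end Extension

theorem stmt_18 (n : ℕ) [NeZero n] (lam₁ mu₁ lam₂ mu₂ lam₃ mu₃ : ℕ → ℕ)
    (hlam : ∀ l ∈ [lam₁, lam₂, lam₃, mu₁, mu₂, mu₃], Antitone l ∧ (Function.support l).Finite)
    (hsub₁ : ∀ i, mu₁ i ≤ lam₁ i) (hsub₂ : ∀ i, mu₂ i ≤ lam₂ i) (hsub₃ : ∀ i, mu₃ i ≤ lam₃ i)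
    (hmidlam : ∀ i, 2 * lam₂ i = lam₁ i + lam₃ i)
    (hmidmu : ∀ i, 2 * mu₂ i = mu₁ i + mu₃ i)
    (z : Fin n → ℝ) (hz : ∀ i, 0 ≤ z i) :
    skewSchur n lam₁ mu₁ z * skewSchur n lam₃ mu₃ z ≤ (skewSchur n lam₂ mu₂ z) ^ 2 := by
  simp only [List.forall_mem_cons, List.not_mem_nil, false_imp_iff, implies_true, and_true] at hlam
  obtain ⟨⟨hl₁, -⟩, ⟨hl₂, fl₂⟩, ⟨hl₃, -⟩, ⟨hm₁, -⟩, ⟨hm₂, fm₂⟩, ⟨hm₃, -⟩⟩ := hlam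
  have supp_of_mid {a b c : ℕ → ℕ} (h : ∀ i, 2 * b i = a i + c i) (i : ℕ) (hb : b i = 0) :
      a i = 0 := by have := h i; omega
  rw [skewSchur_eq_extSchur z hl₁ hm₁ hsub₁, skewSchur_eq_extSchur z hl₂ hm₂ hsub₂,
    skewSchur_eq_extSchur z hl₃ hm₃ hsub₃]
  have hxy : {i | (lam₂ i : ℤ) ≠ mu₂ i}.Finite :=
    (fl₂.union fm₂).subset fun i hi => by by_contra hn; simp_all
  have hee : {i | (lam₁ i : ℤ) - lam₂ i ≠ (mu₁ i : ℤ) - mu₂ i}.Finite := by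
    refine (fl₂.union fm₂).subset fun i hi => ?_
    by_contra hn
    simp only [Set.mem_union, Function.mem_support, not_or, not_not] at hn
    simp [supp_of_mid hmidlam i hn.1, supp_of_mid hmidmu i hn.2, hn] at hi
  have key := extSchur_add_mul_sub_le hz hxy (2 * lam₂ 0 + 2 * mu₂ 0)
    (-(lam₂ 0 + mu₂ 0 : ℤ)) hee
    (fun i => by have := hmidlam i; have := hl₂ (Nat.zero_le i); push_cast; omega)
    (fun i => by have := hmidmu i; have := hm₂ (Nat.zero_le i); push_cast; omega)
  convert key using 3 <;> ext i
  · ring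
  · ring
  · have := hmidlam i; omega
  · have := hmidmu i; omega
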